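/- arXiv:1403.1994 — 5 statements merged into one kernel-verified Lean document; each statement's English description precedes it below -/
import Mathlib

section
/- Let A ⊆ [n] with |A| ≥ 2. Then (1) W_A ∩ ker M_A = {0}, and (2) for every B ⊆ [n] with |B| ≥ 2 such that A is not contained in B, W_A ⊆ ker M_B; that is, W_A is contained in the intersection of the kernels ker M_B over all B ∈ P([n]) that do not contain A. -/
open Finset
abbrev InjWord (n : ℕ) := {l : List (Fin n) // l.Nodup}

namespace IncompleteRankings

variable {n : ℕ}

def content (w : InjWord n) : Finset (Fin n) := w.val.toFinset

def restrict (A : Finset (Fin n)) (w : InjWord n) : InjWord n :=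
  ⟨w.val.filter (fun a => a ∈ A), w.prop.filter _⟩

theorem perm_insertIdx {α : Type*} : ∀ (i : ℕ) (a : α) (l : List α), i ≤ l.length →
    List.Perm (l.insertIdx i a) (a :: l)
  | 0, a, l, _ => by simp
  | (i+1), a, [], h => by simp at h
  | (i+1), a, (x :: l), h => by
      rw [List.insertIdx_succ_cons]
      exact ((perm_insertIdx i a l (by simpa using h)).cons x).trans (List.Perm.swap a x l)

theorem nodup_insertIdx {l : List (Fin n)} (hl : l.Nodup) {a : Fin n} (ha : a ∉ l) (i : ℕ) :
    (l.insertIdx i a).Nodup := by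
  rcases le_or_gt i l.length with hi | hi
  · exact ((perm_insertIdx i a l hi).nodup_iff).mpr (List.nodup_cons.mpr ⟨ha, hl⟩)
  · rw [List.insertIdx_of_length_lt hi]; exact hl

def insertAt (w : InjWord n) (i : ℕ) (a : Fin n) : InjWord n :=
  if h : a ∈ w.val then w else ⟨w.val.insertIdx i a, nodup_insertIdx w.prop h i⟩

abbrev FullWord (n : ℕ) := {w : InjWord n // content w = Finset.univ}

/-- The marginal operator `M_A : L(S_n) → L(Γ(A))`. -/
noncomputable def marginal (n : ℕ) (A : Finset (Fin n)) :
    (FullWord n → ℝ) →ₗ[ℝ] (InjWord n → ℝ) where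
  toFun f := fun π => ∑ σ ∈ Finset.univ.filter (fun σ : FullWord n => restrict A σ.val = π), f σ
  map_add' f g := by funext π; simp [Finset.sum_add_distrib]
  map_smul' c f := by funext π; simp [Finset.mul_sum]

/-- The embedding operator `φ_n : L(Γ_n) → L(S_n)`, sending the Dirac function of `π` to the
indicator function of the set of permutations containing `π` as a contiguous subword. -/
noncomputable def phi (n : ℕ) : (InjWord n → ℝ) →ₗ[ℝ] (FullWord n → ℝ) where
  toFun x := fun σ => ∑ π ∈ Finset.univ.filter (fun π : InjWord n => π.val <:+: σ.val.val), x π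
  map_add' x y := by funext σ; simp [Finset.sum_add_distrib]
  map_smul' c x := by funext σ; simp [Finset.mul_sum]

/-- The space `H_A ⊆ L(Γ(A))`. -/
def HSpace (n : ℕ) (A : Finset (Fin n)) : Submodule ℝ (InjWord n → ℝ) where
  carrier := {x | (∀ w : InjWord n, content w ≠ A → x w = 0) ∧
    ∀ a ∈ A, ∀ ω : InjWord n, content ω = A.erase a →
      ∑ i ∈ Finset.range (ω.val.length + 1), x (insertAt ω i a) = 0}
  add_mem' := by
    rintro x y ⟨hx1, hx2⟩ ⟨hy1, hy2⟩
    refine ⟨fun w hw => by simp [hx1 w hw, hy1 w hw], fun a ha ω hω => ?_⟩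
    simp only [Pi.add_apply, Finset.sum_add_distrib, hx2 a ha ω hω, hy2 a ha ω hω, add_zero]
  zero_mem' := ⟨fun _ _ => rfl, fun a ha ω hω => by simp⟩
  smul_mem' := by
    rintro c x ⟨hx1, hx2⟩
    refine ⟨fun w hw => by simp [hx1 w hw], fun a ha ω hω => ?_⟩
    simp only [Pi.smul_apply, smul_eq_mul, ← Finset.mul_sum, hx2 a ha ω hω, mul_zero]

/-- The space `W_A = φ_n(H_A) ⊆ L(S_n)`. -/
noncomputable def WSpace (n : ℕ) (A : Finset (Fin n)) : Submodule ℝ (FullWord n → ℝ) :=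
  (HSpace n A).map (phi n)

/-- The space `V⁰` of constant functions on `S_n`. -/
def V0 (n : ℕ) : Submodule ℝ (FullWord n → ℝ) :=
  Submodule.span ℝ {(fun _ => 1 : FullWord n → ℝ)}


theorem aux_filter_infix (A : Finset (Fin n)) (u v : List (Fin n)) (w : InjWord n)
    (hw : content w = A) (h : (u ++ w.val ++ v).Nodup) :
    (u ++ w.val ++ v).filter (fun a => a ∈ A) = w.val := by
  subst hw
  have h1 : u.filter (fun a => a ∈ content w) = [] := by
    rw [List.filter_eq_nil_iff]
    intro a ha hc
    simp only [content, List.mem_toFinset, decide_eq_true_eq] at hc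
    simp only [List.nodup_append, List.mem_append] at h
    exact h.1.2.2 a ha a hc rfl
  have h2 : v.filter (fun a => a ∈ content w) = [] := by
    rw [List.filter_eq_nil_iff]
    intro a ha hc
    simp only [content, List.mem_toFinset, decide_eq_true_eq] at hc
    simp only [List.nodup_append, List.mem_append] at h
    exact h.2.2 a (Or.inr hc) a ha rfl
  have h3 : w.val.filter (fun a => a ∈ content w) = w.val := by
    rw [List.filter_eq_self]
    intro a ha
    simpa [content] using ha
  rw [List.filter_append, List.filter_append, h1, h2, h3]
  simp

theorem aux_restrict_of_infix (A : Finset (Fin n)) (σ w : InjWord n)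
    (hw : content w = A) (h : w.val <:+: σ.val) : restrict A σ = w := by
  obtain ⟨u, v, huv⟩ := h
  apply Subtype.ext
  show σ.val.filter (fun a => a ∈ A) = w.val
  rw [← huv]
  exact aux_filter_infix A u v w hw (by rw [huv]; exact σ.prop)

theorem aux_exists_full (w : InjWord n) : ∃ σ : FullWord n, w.val <:+: σ.val.val := by
  have hnd : (w.val ++ (List.finRange n).filter (fun a => a ∉ w.val)).Nodup := by
    rw [List.nodup_append]
    refine ⟨w.prop, (List.nodup_finRange n).filter _, ?_⟩
    rintro a ha b hb rfl
    simp at hb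
    exact hb ha
  refine ⟨⟨⟨_, hnd⟩, ?_⟩, [], (List.finRange n).filter (fun a => a ∉ w.val), by simp⟩
  ext a
  simp [content]
  tauto

theorem aux_part1 (A : Finset (Fin n)) (x : InjWord n → ℝ)
    (hx : ∀ w : InjWord n, content w ≠ A → x w = 0)
    (hk : marginal n A (phi n x) = 0) : x = 0 := by
  funext w
  by_cases hw : content w = A
  swap
  · exact hx w hw
  have h := congrFun hk w
  simp only [marginal, phi, LinearMap.coe_mk, AddHom.coe_mk, Pi.zero_apply] at h
  have h2 : ∀ σ ∈ Finset.univ.filter (fun σ : FullWord n => restrict A σ.val = w),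
      ∑ π ∈ Finset.univ.filter (fun π : InjWord n => π.val <:+: σ.val.val), x π =
      if w.val <:+: σ.val.val then x w else 0 := by
    intro σ hσ
    simp only [Finset.mem_filter, Finset.mem_univ, true_and] at hσ
    rw [Finset.sum_filter]
    rw [Finset.sum_eq_single w]
    · intro b _ hb
      split_ifs with hi
      · apply hx
        intro hc
        exact hb ((aux_restrict_of_infix A σ.val b hc hi).symm.trans hσ)
      · rfl
    · simp
  rw [Finset.sum_congr rfl h2, ← Finset.sum_filter, Finset.sum_const, nsmul_eq_mul] at h
  rcases mul_eq_zero.mp h with h | h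
  · exfalso
    rw [Nat.cast_eq_zero, Finset.card_eq_zero] at h
    obtain ⟨σ, hσ⟩ := aux_exists_full w
    have : σ ∈ (∅ : Finset (FullWord n)) := by
      rw [← h]
      simp only [Finset.mem_filter, Finset.mem_univ, true_and]
      exact ⟨aux_restrict_of_infix A σ.val w hw hσ, hσ⟩
    simp at this
  · exact h

theorem aux_unique {w : List (Fin n)} (hw : w ≠ []) {u v u' v' : List (Fin n)}
    (hn : (u ++ w ++ v).Nodup) (h : u ++ w ++ v = u' ++ w ++ v') : u = u' ∧ v = v' := by
  obtain ⟨c, t, rfl⟩ := List.exists_cons_of_ne_nil hw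
  have hn' := hn
  rw [h] at hn'
  have e : u ++ c :: (t ++ v) = u' ++ c :: (t ++ v') := by simpa using h
  have hc : c ∉ u := by
    intro hc
    simp only [List.nodup_append] at hn
    exact hn.1.2.2 c hc c (by simp) rfl
  have hc' : c ∉ u' := by
    intro hc
    simp only [List.nodup_append] at hn'
    exact hn'.1.2.2 c hc c (by simp) rfl
  have hu : u = u' := by
    have := congrArg (List.takeWhile (fun b => b ≠ c)) e
    rw [List.takeWhile_append_of_pos, List.takeWhile_append_of_pos] at this
    · simpa using this
    · intro b hb; simp; rintro rfl; exact hc' hb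
    · intro b hb; simp; rintro rfl; exact hc hb
  subst hu
  simpa using e

/-- Number of full words restricting to `π` on `B` and containing `w` as an infix. -/
def cnt (B : Finset (Fin n)) (π w : InjWord n) : ℕ :=
  (Finset.univ.filter (fun σ : FullWord n => restrict B σ.val = π ∧ w.val <:+: σ.val.val)).card

theorem aux_cnt_le (B : Finset (Fin n)) (π w w' : InjWord n) (hne : w.val ≠ [])
    (hc : content w = content w') (hB : restrict B w = restrict B w') :
    cnt B π w ≤ cnt B π w' := by
  have hperm : w.val.Perm w'.val := by
    rw [List.perm_ext_iff_of_nodup w.prop w'.prop]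
    intro a
    have := Finset.ext_iff.mp hc a
    simpa [content] using this
  have hne' : w'.val ≠ [] := by
    intro h0
    rw [h0] at hperm
    exact hne hperm.eq_nil
  unfold cnt
  apply Finset.card_le_card_of_forall_subsingleton
    (fun σ τ : FullWord n => ∃ u v, σ.val.val = u ++ w.val ++ v ∧ τ.val.val = u ++ w'.val ++ v)
  · intro σ hσ
    simp only [Finset.mem_filter, Finset.mem_univ, true_and] at hσ
    obtain ⟨hr, u, v, huv⟩ := hσ
    have hp : (σ.val.val).Perm (u ++ w'.val ++ v) := by
      rw [← huv]
      exact (hperm.append_left u).append_right v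
    refine ⟨⟨⟨u ++ w'.val ++ v, hp.nodup_iff.mp σ.val.prop⟩, ?_⟩, ?_, u, v, huv.symm, rfl⟩
    · exact (List.toFinset_eq_of_perm _ _ hp).symm.trans σ.prop
    · simp only [Finset.mem_filter, Finset.mem_univ, true_and]
      refine ⟨?_, u, v, rfl⟩
      rw [← hr]
      apply Subtype.ext
      have hB' := congrArg Subtype.val hB
      simp only [restrict] at hB' ⊢
      rw [← huv]
      simp only [List.filter_append, hB']
  · intro τ _ σ₁ h₁ σ₂ h₂
    obtain ⟨-, u, v, h1, h1'⟩ := h₁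
    obtain ⟨-, u', v', h2, h2'⟩ := h₂
    have hn := τ.val.prop
    rw [h1'] at hn
    obtain ⟨rfl, rfl⟩ := aux_unique hne' hn (h1'.symm.trans h2')
    exact Subtype.ext (Subtype.ext (h1.trans h2.symm))

theorem aux_insertIdx {α : Type*} : ∀ (i : ℕ) (a : α) (l : List α), i ≤ l.length →
    l.insertIdx i a = l.take i ++ a :: l.drop i
  | 0, a, l, _ => by simp
  | (i+1), a, [], h => by simp at h
  | (i+1), a, (x :: l), h => by
      rw [List.insertIdx_succ_cons, aux_insertIdx i a l (by simpa using h)]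
      simp

theorem aux_fiber_sum (A : Finset (Fin n)) (x : InjWord n → ℝ)
    (hx : ∀ w : InjWord n, content w ≠ A → x w = 0) (a : Fin n) (ha : a ∈ A)
    (j : InjWord n) (hj : content j = A.erase a) :
    ∑ w ∈ Finset.univ.filter (fun w : InjWord n => restrict (A.erase a) w = j), x w =
      ∑ i ∈ Finset.range (j.val.length + 1), x (insertAt j i a) := by
  have haj : a ∉ j.val := by
    have : a ∉ content j := by rw [hj]; simp
    simpa [content] using this
  have hval : ∀ i, (insertAt j i a).val = j.val.insertIdx i a := by
    intro i
    simp [insertAt, haj]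
  have hAj : ∀ b, b ∈ j.val ↔ b ≠ a ∧ b ∈ A := by
    intro b
    have := Finset.ext_iff.mp hj b
    simpa [content] using this
  have hins : ∀ i, i ≤ j.val.length →
      j.val.insertIdx i a = j.val.take i ++ a :: j.val.drop i := by
    exact fun i hi => aux_insertIdx i a j.val hi
  symm
  apply Finset.sum_of_injOn (fun i => insertAt j i a)
  · intro i hi k hk hik
    simp only [Finset.coe_range, Set.mem_Iio] at hi hk
    have e := congrArg Subtype.val hik
    simp only [hval] at e
    have := congrArg (List.idxOf a) e
    rw [hins i (by omega), hins k (by omega), 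
      List.idxOf_append_of_notMem (fun h => haj (List.mem_of_mem_take h)),
      List.idxOf_append_of_notMem (fun h => haj (List.mem_of_mem_take h))] at this
    simp at this
    omega
  · intro i hi
    simp only [Finset.coe_range, Set.mem_Iio] at hi
    simp only [Finset.coe_filter, Finset.mem_univ, true_and, Set.mem_ofPred_eq]
    apply Subtype.ext
    simp only [restrict, hval]
    rw [hins i (by omega), List.filter_append, List.filter_cons]
    simp only [Finset.mem_erase, ne_eq, not_true_eq_false, false_and, decide_false,
      Bool.false_eq_true, if_false]
    rw [← List.filter_append, List.take_append_drop, List.filter_eq_self]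
    intro b hb
    simpa using (hAj b).mp hb
  · intro w hw hw'
    simp only [Finset.mem_filter, Finset.mem_univ, true_and] at hw
    apply hx
    intro hc
    apply hw'
    have haw : a ∈ w.val := by
      have : a ∈ content w := by rw [hc]; exact ha
      simpa [content] using this
    obtain ⟨s, t, hst⟩ := List.append_of_mem haw
    have hnd := w.prop
    rw [hst] at hnd
    have hj' : j.val = s ++ t := by
      rw [← hw]
      simp only [restrict, hst]
      rw [List.filter_append, List.filter_cons]
      simp only [Finset.mem_erase, ne_eq, not_true_eq_false, false_and, decide_false,
        Bool.false_eq_true, if_false]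
      rw [← List.filter_append, List.filter_eq_self]
      intro b hb
      have hbA : b ∈ A := by
        rw [← hc]
        simp only [content, List.mem_toFinset, hst]
        simp at hb ⊢
        tauto
      have hba : b ≠ a := by
        rintro rfl
        rw [List.nodup_middle, List.nodup_cons] at hnd
        exact hnd.1 hb
      simp [hba, hbA]
    refine ⟨s.length, ?_, ?_⟩
    · simp [hj']
    · apply Subtype.ext
      simp only [hval]
      rw [hins _ (by simp [hj']), hst, hj']
      simp
  · intro i _
    rfl

theorem aux_part2 (A B : Finset (Fin n)) (x : InjWord n → ℝ) (hx : x ∈ HSpace n A)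
    (hAB : ¬ A ⊆ B) : marginal n B (phi n x) = 0 := by
  obtain ⟨hx1, hx2⟩ := hx
  obtain ⟨a, ha, haB⟩ := Finset.not_subset.mp hAB
  funext π
  simp only [marginal, phi, LinearMap.coe_mk, AddHom.coe_mk, Pi.zero_apply]
  have key : ∑ σ ∈ Finset.univ.filter (fun σ : FullWord n => restrict B σ.val = π),
      ∑ w ∈ Finset.univ.filter (fun w : InjWord n => w.val <:+: σ.val.val), x w =
      ∑ w : InjWord n, (cnt B π w : ℝ) * x w := by
    simp_rw [Finset.sum_filter (fun w : InjWord n => w.val <:+: _)]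
    rw [Finset.sum_comm]
    apply Finset.sum_congr rfl
    intro w _
    rw [← Finset.sum_filter, Finset.sum_const, nsmul_eq_mul, Finset.filter_filter]
    rfl
  rw [key, ← Finset.sum_fiberwise _ (fun w => restrict (A.erase a) w)]
  apply Finset.sum_eq_zero
  intro j _
  have hne : ∀ w : InjWord n, content w = A → w.val ≠ [] := by
    intro w hw h0
    rw [← hw] at ha
    simp [content, h0] at ha
  by_cases hj : content j = A.erase a
  swap
  · apply Finset.sum_eq_zero
    intro w hw
    simp only [Finset.mem_filter, Finset.mem_univ, true_and] at hw
    rw [hx1 w, mul_zero]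
    intro hc
    apply hj
    rw [← hw]
    ext b
    have := Finset.ext_iff.mp hc b
    simp [content, restrict] at this ⊢
    tauto
  · have hres : ∀ w : InjWord n, restrict (A.erase a) w = j → content w = A →
        restrict B w = restrict B j := by
      intro w hw hc
      apply Subtype.ext
      rw [← hw]
      simp only [restrict, List.filter_filter]
      apply List.filter_congr
      intro b hb
      have hbA : b ∈ A := by
        rw [← hc]
        simpa [content] using hb
      by_cases hbB : b ∈ B
      · have : b ≠ a := by rintro rfl; exact haB hbB
        simp [hbA, hbB, this]
      · simp [hbB]
    have hcn : ∃ c : ℕ, ∀ w : InjWord n, restrict (A.erase a) w = j → content w = A →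
        cnt B π w = c := by
      by_cases hex : ∃ w : InjWord n, restrict (A.erase a) w = j ∧ content w = A
      · obtain ⟨w', h1, h2⟩ := hex
        refine ⟨cnt B π w', fun w h3 h4 => le_antisymm ?_ ?_⟩
        · exact aux_cnt_le B π w w' (hne w h4) (h4.trans h2.symm)
            ((hres w h3 h4).trans (hres w' h1 h2).symm)
        · exact aux_cnt_le B π w' w (hne w' h2) (h2.trans h4.symm)
            ((hres w' h1 h2).trans (hres w h3 h4).symm)
      · exact ⟨0, fun w h3 h4 => (hex ⟨w, h3, h4⟩).elim⟩
    obtain ⟨c, hc⟩ := hcn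
    have : ∀ w ∈ Finset.univ.filter (fun w : InjWord n => restrict (A.erase a) w = j),
        (cnt B π w : ℝ) * x w = c * x w := by
      intro w hw
      simp only [Finset.mem_filter, Finset.mem_univ, true_and] at hw
      by_cases h : content w = A
      · rw [hc w hw h]
      · rw [hx1 w h]; simp
    rw [Finset.sum_congr rfl this, ← Finset.mul_sum, aux_fiber_sum A x hx1 a ha j hj,
      hx2 a ha j hj, mul_zero]

/-- For `A ∈ P([n])`: `W_A ∩ ker M_A = {0}`, and `W_A ⊆ ker M_B` for every
`B ∈ P([n])` not containing `A`. -/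
theorem statement6 (n : ℕ) (A : Finset (Fin n)) (hA : 2 ≤ A.card) :
    WSpace n A ⊓ LinearMap.ker (marginal n A) = ⊥ ∧
    (∀ B : Finset (Fin n), 2 ≤ B.card → ¬ A ⊆ B →
      WSpace n A ≤ LinearMap.ker (marginal n B)) := by
  refine ⟨?_, ?_⟩
  · rw [eq_bot_iff]
    rintro f ⟨⟨x, hx, rfl⟩, hk⟩
    rw [aux_part1 A x hx.1 hk]
    simp
  · rintro B - hAB f ⟨x, hx, rfl⟩
    exact aux_part2 A B x hx hAB

end IncompleteRankings
end

section
/- For every integer k with 2 ≤ k ≤ n, the dimension of the real vector space H_{{1,…,k}} equals d_k, the number of derangements of a k-element set. -/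
open Finset
namespace IncompleteRankings

variable {n : ℕ}

/-- Deletion of the letter `a`. -/
noncomputable def del (a : Fin n) : (InjWord n → ℝ) →ₗ[ℝ] (InjWord n → ℝ) where
  toFun x := fun ω => ∑ w : InjWord n, if a ∈ w.val ∧ w.val.erase a = ω.val then x w else 0
  map_add' x y := by
    funext ω
    simp only [Pi.add_apply, ← Finset.sum_add_distrib]
    refine Finset.sum_congr rfl fun w _ => ?_
    split_ifs <;> simp
  map_smul' c x := by
    funext ω
    simp [Finset.mul_sum]

theorem del_apply (a : Fin n) (x : InjWord n → ℝ) (ω : InjWord n) :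
    del a x ω = ∑ w : InjWord n, if a ∈ w.val ∧ w.val.erase a = ω.val then x w else 0 := rfl

theorem del_del (a b : Fin n) (x : InjWord n → ℝ) (ω : InjWord n) :
    del b (del a x) ω = ∑ w : InjWord n,
      if a ∈ w.val ∧ b ∈ w.val.erase a ∧ (w.val.erase a).erase b = ω.val then x w else 0 := by
  rw [del_apply]
  have h1 : ∀ v : InjWord n, (if b ∈ v.val ∧ v.val.erase b = ω.val then del a x v else 0)
      = ∑ w : InjWord n, if (b ∈ v.val ∧ v.val.erase b = ω.val) ∧
          (a ∈ w.val ∧ w.val.erase a = v.val) then x w else 0 := by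
    intro v
    rw [del_apply]
    by_cases h : b ∈ v.val ∧ v.val.erase b = ω.val
    · simp [h]
    · simp only [h, if_false, false_and, Finset.sum_const_zero]
  rw [Finset.sum_congr rfl (fun v _ => h1 v), Finset.sum_comm]
  refine Finset.sum_congr rfl fun w _ => ?_
  rw [Finset.sum_eq_single (⟨w.val.erase a, w.prop.erase a⟩ : InjWord n)]
  · refine if_congr ?_ rfl rfl
    simp only [and_true]
    tauto
  · intro v _ hv
    rw [if_neg]
    rintro ⟨_, _, h⟩
    exact hv (Subtype.ext h.symm)
  · simp

theorem del_comm {a b : Fin n} (hab : a ≠ b) (x : InjWord n → ℝ) :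
    del b (del a x) = del a (del b x) := by
  funext ω
  rw [del_del, del_del]
  refine Finset.sum_congr rfl fun w _ => ?_
  refine if_congr ?_ rfl rfl
  rw [List.mem_erase_of_ne hab, List.mem_erase_of_ne hab.symm, List.erase_comm]
  tauto

theorem erase_insertIdx {l : List (Fin n)} {a : Fin n} (ha : a ∉ l) :
    ∀ i, i ≤ l.length → (l.insertIdx i a).erase a = l := by
  induction l with
  | nil => intro i hi; simp at hi; subst hi; simp
  | cons c t ih =>
    intro i hi
    cases i with
    | zero => simp
    | succ i =>
      rw [List.insertIdx_succ_cons]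
      simp only [List.mem_cons, not_or] at ha
      rw [List.erase_cons_tail (by simpa using Ne.symm ha.1), ih ha.2 i (by simpa using hi)]

theorem exists_insertIdx {w : List (Fin n)} {a : Fin n} (ha : a ∈ w) :
    ∃ i, i ≤ (w.erase a).length ∧ (w.erase a).insertIdx i a = w := by
  induction w with
  | nil => simp at ha
  | cons c t ih =>
    by_cases h : c = a
    · subst h
      exact ⟨0, by simp, by simp⟩
    · have : a ∈ t := by
        rcases List.mem_cons.mp ha with h' | h'
        · exact absurd h'.symm h
        · exact h'
      obtain ⟨i, hi, he⟩ := ih this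
      rw [List.erase_cons_tail (by simpa using h)]
      exact ⟨i+1, by simpa using hi, by rw [List.insertIdx_succ_cons, he]⟩

theorem insertIdx_inj {l : List (Fin n)} {a : Fin n} (ha : a ∉ l) :
    ∀ i j, i ≤ l.length → j ≤ l.length → l.insertIdx i a = l.insertIdx j a → i = j := by
  induction l with
  | nil => intro i j hi hj _; simp at hi hj; omega
  | cons c t ih =>
    intro i j hi hj h
    simp only [List.mem_cons, not_or] at ha
    cases i with
    | zero =>
      cases j with
      | zero => rfl
      | succ j => simp at h; exact absurd h.1 ha.1
    | succ i =>
      cases j with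
      | zero => simp at h; exact absurd h.1.symm ha.1
      | succ j =>
        simp only [List.insertIdx_succ_cons, List.cons.injEq, true_and] at h
        rw [ih ha.2 i j (by simpa using hi) (by simpa using hj) h]

theorem sum_insertAt (a : Fin n) (x : InjWord n → ℝ) (ω : InjWord n) (ha : a ∉ ω.val) :
    ∑ i ∈ Finset.range (ω.val.length + 1), x (insertAt ω i a) = del a x ω := by
  rw [del_apply, ← Finset.sum_filter]
  have hv : ∀ i, (insertAt ω i a).val = ω.val.insertIdx i a := by
    intro i; simp [insertAt, ha]
  refine Finset.sum_bij (fun i _ => insertAt ω i a) ?_ ?_ ?_ ?_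
  · intro i hi
    have hi' : i ≤ ω.val.length := by simpa [Nat.lt_succ_iff] using hi
    simp only [Finset.mem_filter, Finset.mem_univ, true_and, hv]
    refine ⟨?_, erase_insertIdx ha i hi'⟩
    exact (perm_insertIdx i a _ hi').mem_iff.mpr (by simp)
  · intro i hi j hj h
    have hi' : i ≤ ω.val.length := by simpa [Nat.lt_succ_iff] using hi
    have hj' : j ≤ ω.val.length := by simpa [Nat.lt_succ_iff] using hj
    have := congrArg Subtype.val h
    simp only [hv] at this
    exact insertIdx_inj ha i j hi' hj' this
  · intro w hw
    simp only [Finset.mem_filter, Finset.mem_univ, true_and] at hw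
    obtain ⟨i, hi, he⟩ := exists_insertIdx hw.1
    rw [hw.2] at hi he
    exact ⟨i, by simpa [Nat.lt_succ_iff] using hi, Subtype.ext (by rw [hv, he])⟩
  · intro i _; rfl

theorem del_of_mem (a : Fin n) (x : InjWord n → ℝ) (ω : InjWord n) (ha : a ∈ ω.val) :
    del a x ω = 0 := by
  rw [del_apply]
  refine Finset.sum_eq_zero fun w _ => ?_
  rw [if_neg]
  rintro ⟨_, h⟩
  rw [← h] at ha
  exact absurd ha (w.prop.not_mem_erase)

theorem content_eq_of_erase {a : Fin n} {w ω : InjWord n} (ha : a ∈ w.val)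
    (h : w.val.erase a = ω.val) : content ω = (content w).erase a := by
  ext b
  simp only [content, List.mem_toFinset, Finset.mem_erase, ← h]
  rw [w.prop.mem_erase_iff]

/-- Functions supported on content `A`, killed by the deletions in `S`. -/
noncomputable def KS (A S : Finset (Fin n)) : Submodule ℝ (InjWord n → ℝ) where
  carrier := {x | (∀ w : InjWord n, content w ≠ A → x w = 0) ∧ ∀ a ∈ S, del a x = 0}
  add_mem' := by
    rintro x y ⟨hx1, hx2⟩ ⟨hy1, hy2⟩
    exact ⟨fun w hw => by simp [hx1 w hw, hy1 w hw],
      fun a ha => by rw [map_add, hx2 a ha, hy2 a ha, add_zero]⟩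
  zero_mem' := ⟨fun _ _ => rfl, fun a ha => by simp⟩
  smul_mem' := by
    rintro c x ⟨hx1, hx2⟩
    exact ⟨fun w hw => by simp [hx1 w hw],
      fun a ha => by rw [map_smul, hx2 a ha, smul_zero]⟩

theorem mem_KS {A S : Finset (Fin n)} {x : InjWord n → ℝ} : x ∈ KS A S ↔
    (∀ w : InjWord n, content w ≠ A → x w = 0) ∧ ∀ a ∈ S, del a x = 0 := Iff.rfl

theorem del_supp {A : Finset (Fin n)} {x : InjWord n → ℝ}
    (hx : ∀ w : InjWord n, content w ≠ A → x w = 0) (a : Fin n) :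
    ∀ w : InjWord n, content w ≠ A.erase a → del a x w = 0 := by
  intro ω hω
  rw [del_apply]
  refine Finset.sum_eq_zero fun w _ => ?_
  split_ifs with h
  · refine hx w fun hc => hω ?_
    rw [content_eq_of_erase h.1 h.2, hc]
  · rfl

theorem HSpace_eq (A : Finset (Fin n)) : HSpace n A = KS A A := by
  ext x
  rw [mem_KS]
  change ((∀ w : InjWord n, content w ≠ A → x w = 0) ∧
    ∀ a ∈ A, ∀ ω : InjWord n, content ω = A.erase a →
      ∑ i ∈ Finset.range (ω.val.length + 1), x (insertAt ω i a) = 0) ↔ _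
  refine and_congr_right fun hx => ?_
  refine forall₂_congr fun a ha => ?_
  have key : ∀ ω : InjWord n, content ω = A.erase a → a ∉ ω.val := by
    intro ω h h'
    have : a ∈ content ω := by simpa [content] using h'
    rw [h] at this
    simp at this
  constructor
  · intro h
    funext ω
    by_cases hc : content ω = A.erase a
    · rw [← sum_insertAt a x ω (key ω hc), h ω hc]; rfl
    · exact del_supp hx a ω hc
  · intro h ω hc
    rw [sum_insertAt a x ω (key ω hc), h]; rfl

/-- Insertion of `a` at the front. -/
noncomputable def mu (a : Fin n) (y : InjWord n → ℝ) : InjWord n → ℝ := fun w =>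
  if w.val.head? = some a then y ⟨w.val.tail, w.prop.tail⟩ else 0

theorem del_mu_self {a : Fin n} (y : InjWord n → ℝ) (ω : InjWord n) (ha : a ∉ ω.val) :
    del a (mu a y) ω = y ω := by
  rw [del_apply, Finset.sum_eq_single (⟨a :: ω.val, List.nodup_cons.mpr ⟨ha, ω.prop⟩⟩ : InjWord n)]
  · simp [mu]
  · rintro ⟨w, hw⟩ _ hne
    split_ifs with h
    · rw [mu, if_neg]
      intro hh
      apply hne
      cases w with
      | nil => simp at hh
      | cons c t =>
        simp at hh
        subst hh
        simp at h
        simp [h]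
    · rfl
  · simp

theorem del_mu_ne {a b : Fin n} (hab : b ≠ a) (y : InjWord n → ℝ) :
    del b (mu a y) = mu a (del b y) := by
  funext ω
  by_cases hb : b ∈ ω.val
  · rw [del_of_mem _ _ _ hb, mu]
    split_ifs with h
    · rw [del_of_mem]
      obtain ⟨l, hl⟩ := ω
      cases l with
      | nil => simp at hb
      | cons c t =>
        simp at h
        subst h
        simpa [hab] using hb
    · rfl
  · rw [← sum_insertAt _ _ _ hb, Finset.sum_range_succ']
    obtain ⟨l, hl⟩ := ω
    simp only at hb
    have h0 : mu a y (insertAt ⟨l, hl⟩ 0 b) = 0 := by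
      simp [mu, insertAt, hb, hab]
    rw [h0, add_zero]
    cases l with
    | nil => simp [mu]
    | cons c t =>
      by_cases hc : c = a
      · subst hc
        have hbt : b ∉ t := fun h => hb (List.mem_cons_of_mem _ h)
        rw [mu, if_pos (by simp), ← sum_insertAt _ _ _ (by simpa using hbt)]
        refine Finset.sum_congr (by simp) fun i _ => ?_
        simp [mu, insertAt, hab, hbt]
      · rw [mu, if_neg (by simpa using hc)]
        refine Finset.sum_eq_zero fun i _ => ?_
        simp only [insertAt, hb, dite_false, mu, List.insertIdx_succ_cons, List.head?_cons,
          Option.some.injEq, hc, if_false]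

theorem mu_zero (a : Fin n) : mu a (0 : InjWord n → ℝ) = 0 := by
  funext w; simp [mu]

theorem map_del (A S : Finset (Fin n)) (a : Fin n) (ha : a ∈ A) (haS : a ∉ S) :
    (KS A S).map (del a) = KS (A.erase a) S := by
  ext y
  constructor
  · rintro ⟨x, ⟨hx1, hx2⟩, rfl⟩
    refine ⟨del_supp hx1 a, fun b hb => ?_⟩
    have : a ≠ b := fun h => haS (h ▸ hb)
    rw [del_comm this, hx2 b hb, map_zero]
  · rintro ⟨hy1, hy2⟩
    refine ⟨mu a y, ⟨fun w hw => ?_, fun b hb => ?_⟩, ?_⟩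
    · rw [mu]
      split_ifs with h
      · apply hy1
        intro hc
        apply hw
        obtain ⟨l, hl⟩ := w
        cases l with
        | nil => simp at h
        | cons c t =>
          simp at h
          subst h
          simp only [content, List.tail_cons, List.toFinset_cons] at hc ⊢
          rw [hc, Finset.insert_erase ha]
      · rfl
    · have : b ≠ a := fun h => haS (h ▸ hb)
      rw [del_mu_ne this, hy2 b hb, mu_zero]
    · funext ω
      by_cases h : a ∈ ω.val
      · rw [del_of_mem _ _ _ h, hy1]
        intro hc
        have : a ∈ content ω := by simpa [content] using h
        rw [hc] at this
        simp at this
      · exact del_mu_self y ω h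

theorem finrank_step (A S : Finset (Fin n)) (a : Fin n) (ha : a ∈ A) (haS : a ∉ S) :
    Module.finrank ℝ (KS (A.erase a) S) + Module.finrank ℝ (KS A (insert a S))
      = Module.finrank ℝ (KS A S) := by
  have h := LinearMap.finrank_range_add_finrank_ker ((del a).domRestrict (KS A S))
  rw [LinearMap.range_domRestrict, map_del A S a ha haS] at h
  have hle : KS A (insert a S) ≤ KS A S := fun x hx =>
    ⟨hx.1, fun b hb => hx.2 b (Finset.mem_insert_of_mem hb)⟩
  have hker : LinearMap.ker ((del a).domRestrict (KS A S))
      = (KS A (insert a S)).comap (KS A S).subtype := by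
    ext ⟨x, hx⟩
    simp only [LinearMap.mem_ker, LinearMap.domRestrict_apply, Submodule.mem_comap,
      Submodule.subtype_apply, mem_KS]
    constructor
    · intro h0
      refine ⟨hx.1, fun b hb => ?_⟩
      rcases Finset.mem_insert.mp hb with rfl | hb
      · exact h0
      · exact hx.2 b hb
    · intro h0
      exact h0.2 a (Finset.mem_insert_self _ _)
  rw [hker, (Submodule.comapSubtypeEquivOfLe hle).finrank_eq] at h
  exact h

theorem card_words (A : Finset (Fin n)) :
    Fintype.card {w : InjWord n // content w = A} = (A.card).factorial := by
  have hp : ∀ l : List (Fin n), l ∈ A.toList.permutations.toFinset ↔ l.Nodup ∧ l.toFinset = A := by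
    intro l
    rw [List.mem_toFinset, List.mem_permutations]
    constructor
    · intro h
      refine ⟨h.nodup_iff.mpr A.nodup_toList, ?_⟩
      ext b; simp [h.mem_iff]
    · rintro ⟨h1, h2⟩
      rw [List.perm_ext_iff_of_nodup h1 A.nodup_toList]
      intro b
      rw [Finset.mem_toList, ← h2, List.mem_toFinset]
  have hc : A.toList.permutations.toFinset.card = A.card.factorial := by
    rw [List.toFinset_card_of_nodup (List.nodup_permutations _ A.nodup_toList),
      List.length_permutations, Finset.length_toList]
  rw [← hc, ← Fintype.card_coe]
  refine Fintype.card_congr ?_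
  exact
    { toFun := fun w => ⟨w.val.val, (hp _).mpr ⟨w.val.prop, w.prop⟩⟩
      invFun := fun l => ⟨⟨l.val, ((hp _).mp l.prop).1⟩, ((hp _).mp l.prop).2⟩
      left_inv := fun w => rfl
      right_inv := fun l => rfl }

/-- Functions supported on `A` are functions on the words with content `A`. -/
noncomputable def suppEquiv (A : Finset (Fin n)) :
    KS A ∅ ≃ₗ[ℝ] ({w : InjWord n // content w = A} → ℝ) where
  toFun x := fun w => x.val w.val
  map_add' x y := rfl
  map_smul' c x := rfl
  invFun y := ⟨fun w => if h : content w = A then y ⟨w, h⟩ else 0,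
    ⟨fun w hw => dif_neg hw, fun a ha => by simp at ha⟩⟩
  left_inv x := by
    apply Subtype.ext
    funext w
    by_cases h : content w = A
    · simp [h]
    · simp [h, x.prop.1 w h]
  right_inv y := by
    funext w
    simp [w.prop]

theorem finrank_base (A : Finset (Fin n)) :
    Module.finrank ℝ (KS A ∅) = (A.card).factorial := by
  rw [(suppEquiv A).finrank_eq, Module.finrank_fintype_fun_eq_card, card_words]

theorem finrank_KS (S : Finset (Fin n)) : ∀ (A : Finset (Fin n)) (i : ℕ), S ⊆ A →
    A.card = i + S.card →
    (Module.finrank ℝ (KS A S) : ℤ) = ((fwdDiff 1)^[S.card] (fun m : ℕ => (m.factorial : ℤ))) i := by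
  induction S using Finset.induction_on with
  | empty =>
    intro A i _ h
    rw [finrank_base]
    simp at h
    simp [h]
  | insert a S ha ih =>
    intro A i hS hc
    rw [Finset.card_insert_of_notMem ha] at hc ⊢
    have haA : a ∈ A := hS (Finset.mem_insert_self _ _)
    have hSA : S ⊆ A := fun b hb => hS (Finset.mem_insert_of_mem hb)
    have hSA' : S ⊆ A.erase a := fun b hb =>
      Finset.mem_erase.mpr ⟨fun h => ha (h ▸ hb), hSA hb⟩
    have h := finrank_step A S a haA ha
    have h1 := ih A (i + 1) hSA (by omega)
    have h2 := ih (A.erase a) i hSA' (by rw [Finset.card_erase_of_mem haA]; omega)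
    rw [Function.iterate_succ_apply', fwdDiff, ← h1, ← h2, ← h]
    push_cast
    ring

theorem fwdDiff_factorial (k : ℕ) :
    ((fwdDiff 1)^[k] (fun m : ℕ => (m.factorial : ℤ))) 0 = numDerangements k := by
  rw [fwdDiff_iter_eq_sum_shift, numDerangements_sum, ← Finset.sum_range_reflect]
  refine Finset.sum_congr rfl fun j hj => ?_
  have hj' : j ≤ k := by simpa [Nat.lt_succ_iff] using hj
  have e1 : k + 1 - 1 - j = k - j := by omega
  have e2 : k - (k - j) = j := by omega
  have e3 : k.choose (k - j) * (k - j).factorial = (j + 1).ascFactorial (k - j) := by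
    have h1 := Nat.choose_mul_factorial_mul_factorial (Nat.sub_le k j)
    rw [e2] at h1
    have h2 := Nat.factorial_mul_ascFactorial j (k - j)
    rw [Nat.add_sub_cancel' hj'] at h2
    have := Nat.factorial_pos j
    apply Nat.eq_of_mul_eq_mul_left this
    rw [h2, ← h1]; ring
  rw [e1, e2, ← e3]
  simp
  ring

/-- For `2 ≤ k ≤ n`, `dim H_{{1,…,k}} = d_k`, the number of derangements of
a `k`-element set. -/
theorem statement8 (n k : ℕ) (hk2 : 2 ≤ k) (hkn : k ≤ n) :
    Module.finrank ℝ (HSpace n (Finset.univ.filter (fun i : Fin n => (i : ℕ) < k)))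
      = numDerangements k := by
  have hcard : (Finset.univ.filter (fun i : Fin n => (i : ℕ) < k)).card = k := by
    rw [Fin.card_filter_val_lt]; omega
  rw [HSpace_eq]
  have h := finrank_KS _ (Finset.univ.filter (fun i : Fin n => (i : ℕ) < k)) 0
    (Finset.Subset.refl _) (by simp)
  rw [hcard, fwdDiff_factorial] at h
  exact_mod_cast h

end IncompleteRankings
end

section
/- Let A ∈ P([n]). Then the subspaces ker M_A and V^0 + Σ_{B ∈ P(A)} W_B are complementary in L(S_n): their intersection is {0} and their sum is L(S_n), where P(A) denotes the collection of subsets of A of cardinality at least 2. Moreover, ker M_A equals the (direct) sum of the subspaces W_B over all B ∈ P([n]) with B not contained in A. -/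
open Finset
namespace IncompleteRankings

variable {n : ℕ}

/-- Inserting then deleting a fresh letter. -/
theorem filter_insertIdx {α : Type*} [DecidableEq α] (b : α) : ∀ (ω : List α) (i : ℕ), b ∉ ω →
    (ω.insertIdx i b).filter (fun a => a ≠ b) = ω
  | ω, 0, h => by
      simp only [List.insertIdx_zero]
      rw [List.filter_cons_of_neg (by simp)]
      exact List.filter_eq_self.2 (fun a ha => by
        simp only [ne_eq, decide_eq_true_eq]; rintro rfl; exact h ha)
  | [], (i+1), _ => by simp
  | (x :: l), (i+1), h => by
      simp only [List.mem_cons, not_or] at h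
      rw [List.insertIdx_succ_cons, List.filter_cons_of_pos (by simpa using fun h' => h.1 h'.symm),
        filter_insertIdx b l i h.2]

/-- Deleting then reinserting a letter. -/
theorem insertIdx_filter {α : Type*} [DecidableEq α] (b : α) : ∀ (τ : List α), τ.Nodup → b ∈ τ →
    (τ.filter (fun a => a ≠ b)).insertIdx (τ.idxOf b) b = τ
  | [], _, h => by simp at h
  | (x :: l), hn, h => by
      rw [List.nodup_cons] at hn
      by_cases hx : x = b
      · subst hx
        rw [List.filter_cons_of_neg (by simp), List.idxOf_cons_self, List.insertIdx_zero,
          List.filter_eq_self.2 (fun a ha => by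
            simp only [ne_eq, decide_eq_true_eq]; rintro rfl; exact hn.1 ha)]
      · have hb : b ∈ l := by
          rcases List.mem_cons.1 h with h | h
          · exact absurd h.symm hx
          · exact h
        rw [List.filter_cons_of_pos (by simpa using hx), List.idxOf_cons_ne _ hx,
          List.insertIdx_succ_cons, insertIdx_filter b l hn.2 hb]

theorem sum_insertIdx {b : Fin n} {ω τ : List (Fin n)} (hτ : τ.Nodup) (hb : b ∈ τ) (hω : b ∉ ω) :
    (∑ i ∈ Finset.range (ω.length + 1), if τ = ω.insertIdx i b then (1 : ℝ) else 0)
      = if τ.filter (fun a => a ≠ b) = ω then 1 else 0 := by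
  split_ifs with h
  · rw [Finset.sum_eq_single (τ.idxOf b)]
    · rw [if_pos]
      rw [← h, insertIdx_filter b τ hτ hb]
    · intro i hi hne
      rw [if_neg]
      intro h2
      apply hne
      have h3 : ω.insertIdx (τ.idxOf b) b = τ := by rw [← h, insertIdx_filter b τ hτ hb]
      refine List.injOn_insertIdx_index_of_notMem ω b hω ?_ ?_ (h2.symm.trans h3.symm)
      · simp at hi ⊢; omega
      · have := List.idxOf_lt_length_of_mem hb
        have h4 : τ.length ≤ ω.length + 1 := by
          rw [← h3]; exact List.length_insertIdx_le_succ ..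
        simp; omega
    · intro hi
      exfalso; apply hi
      have h3 : ω.insertIdx (τ.idxOf b) b = τ := by rw [← h, insertIdx_filter b τ hτ hb]
      have := List.idxOf_lt_length_of_mem hb
      have h4 : τ.length ≤ ω.length + 1 := by
          rw [← h3]; exact List.length_insertIdx_le_succ ..
      simp; omega
  · apply Finset.sum_eq_zero
    intro i _
    rw [if_neg]
    rintro rfl
    exact h (filter_insertIdx b ω i hω)

theorem mem_content {w : InjWord n} {a : Fin n} : a ∈ content w ↔ a ∈ w.val := by
  simp [content]

theorem sum_insertAt_s10 {b : Fin n} {ω τ : InjWord n} (hb : b ∈ content τ) (hω : b ∉ content ω) :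
    (∑ i ∈ Finset.range (ω.val.length + 1), if τ = insertAt ω i b then (1 : ℝ) else 0)
      = if restrict ((content τ).erase b) τ = ω then 1 else 0 := by
  rw [mem_content] at hb hω
  have h := sum_insertIdx τ.prop hb hω
  have e1 : ∀ i, (τ = insertAt ω i b) ↔ τ.val = ω.val.insertIdx i b := by
    intro i
    rw [insertAt, dif_neg hω, Subtype.ext_iff]
  have e2 : (restrict ((content τ).erase b) τ = ω) ↔ τ.val.filter (fun a => a ≠ b) = ω.val := by
    rw [Subtype.ext_iff, restrict]
    have : τ.val.filter (fun a => a ∈ (content τ).erase b) = τ.val.filter (fun a => a ≠ b) := by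
      apply List.filter_congr
      intro a ha
      simp [mem_content, ha]
    rw [← this]
  simp only [e1, e2]
  exact h

theorem content_restrict (A : Finset (Fin n)) (w : InjWord n) :
    content (restrict A w) = A ∩ content w := by
  ext a; simp [mem_content, restrict, and_comm]

theorem restrict_restrict (A B : Finset (Fin n)) (h : A ⊆ B) (w : InjWord n) :
    restrict A (restrict B w) = restrict A w := by
  apply Subtype.ext
  simp only [restrict, List.filter_filter]
  apply List.filter_congr
  intro a _
  by_cases ha : a ∈ A
  · simp [ha, h ha]
  · simp [ha]

theorem marginal_apply (A : Finset (Fin n)) (f : FullWord n → ℝ) (π : InjWord n) :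
    marginal n A f π = ∑ σ : FullWord n, if restrict A σ.val = π then f σ else 0 := by
  simp [marginal, Finset.sum_filter]

theorem phi_apply (x : InjWord n → ℝ) (σ : FullWord n) :
    phi n x σ = ∑ π : InjWord n, if π.val <:+: σ.val.val then x π else 0 := by
  simp [phi, Finset.sum_filter]

theorem marginal_eq_zero_of_content (A : Finset (Fin n)) (f : FullWord n → ℝ) (π : InjWord n)
    (h : content π ≠ A) : marginal n A f π = 0 := by
  rw [marginal_apply]
  apply Finset.sum_eq_zero
  intro σ _
  rw [if_neg]
  rintro rfl
  apply h
  rw [content_restrict, σ.prop, Finset.inter_univ]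

/-- L3: marginal lies in `H_B`. -/
theorem marginal_mem (B : Finset (Fin n)) (g : FullWord n → ℝ)
    (h : ∀ b ∈ B, marginal n (B.erase b) g = 0) : marginal n B g ∈ HSpace n B := by
  refine ⟨marginal_eq_zero_of_content B g, fun b hb ω hω => ?_⟩
  have h1 : ∀ i, marginal n B g (insertAt ω i b) =
      ∑ σ : FullWord n, g σ * (if restrict B σ.val = insertAt ω i b then 1 else 0) := by
    intro i; rw [marginal_apply]; simp
  simp only [h1]
  rw [Finset.sum_comm]
  have h2 := congrFun (h b hb) ω
  rw [marginal_apply] at h2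
  refine Eq.trans ?_ h2
  apply Finset.sum_congr rfl
  intro σ _
  have hc : content (restrict B σ.val) = B := by
    rw [content_restrict, σ.prop, Finset.inter_univ]
  rw [← Finset.mul_sum, sum_insertAt_s10 (by rw [hc]; exact hb) (by rw [hω]; simp), hc,
    restrict_restrict _ _ (Finset.erase_subset _ _)]
  simp

/-- Sums over words with content `B` against functions not seeing `b` vanish on `H_B`. -/
theorem sum_H {B : Finset (Fin n)} {x : InjWord n → ℝ} (hx : x ∈ HSpace n B) {b : Fin n}
    (hb : b ∈ B) (G : InjWord n → ℝ) (hG : ∀ τ, content τ = B → G τ = G (restrict (B.erase b) τ)) :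
    ∑ τ : InjWord n, G τ * x τ = 0 := by
  have key : ∀ τ : InjWord n, G τ * x τ =
      ∑ ω ∈ Finset.univ.filter (fun ω : InjWord n => content ω = B.erase b), G ω *
        ∑ i ∈ Finset.range (ω.val.length + 1),
          (if τ = insertAt ω i b then (1 : ℝ) else 0) * x τ := by
    intro τ
    by_cases hc : content τ = B
    · rw [Finset.sum_congr rfl (g := fun ω => if restrict (B.erase b) τ = ω then G ω * x τ else 0)]
      · rw [Finset.sum_ite_eq, if_pos, hG τ hc]
        simp [content_restrict, hc, Finset.erase_inter]
      · intro ω hω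
        simp only [Finset.mem_filter, Finset.mem_univ, true_and] at hω
        rw [← Finset.sum_mul, sum_insertAt_s10 (by rw [hc]; exact hb) (by rw [hω]; simp), hc]
        split_ifs <;> simp
    · rw [hx.1 τ hc]; simp
  rw [Finset.sum_congr rfl (fun τ _ => key τ), Finset.sum_comm]
  apply Finset.sum_eq_zero
  intro ω hω
  simp only [Finset.mem_filter, Finset.mem_univ, true_and] at hω
  rw [← Finset.mul_sum, Finset.sum_comm]
  have := hx.2 b hb ω hω
  simp only [ite_mul, one_mul, zero_mul, Finset.sum_ite_eq', Finset.mem_univ, if_true]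
  rw [this, mul_zero]

/-- Pairs of words completing a word with content `B`. -/
def pairs (B : Finset (Fin n)) : Finset (InjWord n × InjWord n) :=
  Finset.univ.filter (fun p => (p.1.val ++ p.2.val).Nodup ∧ (p.1.val ++ p.2.val).toFinset = Bᶜ)

theorem pairs_spec {B : Finset (Fin n)} {p : InjWord n × InjWord n} (hp : p ∈ pairs B)
    {τ : InjWord n} (hτ : content τ = B) : (p.1.val ++ τ.val ++ p.2.val).Nodup ∧
      (p.1.val ++ τ.val ++ p.2.val).toFinset = Finset.univ := by
  simp only [pairs, Finset.mem_filter, Finset.mem_univ, true_and] at hp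
  have hperm : List.Perm (p.1.val ++ τ.val ++ p.2.val) (τ.val ++ (p.1.val ++ p.2.val)) := by
    rw [← List.append_assoc]
    exact List.perm_append_comm.append_right _
  constructor
  · rw [hperm.nodup_iff, List.nodup_append']
    refine ⟨τ.prop, hp.1, ?_⟩
    intro a ha hb
    rw [← List.mem_toFinset, hp.2, ← hτ, Finset.mem_compl, mem_content] at hb
    exact hb ha
  · rw [List.toFinset_eq_of_perm _ _ hperm, List.toFinset_append, hp.2, ← hτ]
    exact Finset.union_compl _

theorem sum_phi {B : Finset (Fin n)} (hB : B.Nonempty) {x : InjWord n → ℝ}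
    (hx : ∀ w, content w ≠ B → x w = 0) (F : List (Fin n) → ℝ) :
    ∑ σ : FullWord n, F σ.val.val * phi n x σ =
      ∑ p ∈ pairs B, ∑ τ : InjWord n, F (p.1.val ++ τ.val ++ p.2.val) * x τ := by
  have hL : ∑ σ : FullWord n, F σ.val.val * phi n x σ =
      ∑ q ∈ (Finset.univ : Finset (FullWord n × InjWord n)).filter
        (fun q => q.2.val <:+: q.1.val.val ∧ content q.2 = B), F q.1.val.val * x q.2 := by
    rw [Finset.sum_filter, ← Finset.univ_product_univ, Finset.sum_product]
    apply Finset.sum_congr rfl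
    intro σ _
    rw [phi_apply, Finset.mul_sum]
    apply Finset.sum_congr rfl
    intro τ _
    by_cases h : content τ = B
    · simp [h]
    · simp [h, hx τ h]
  have hR : ∑ p ∈ pairs B, ∑ τ : InjWord n, F (p.1.val ++ τ.val ++ p.2.val) * x τ =
      ∑ q ∈ pairs B ×ˢ Finset.univ.filter (fun τ : InjWord n => content τ = B),
        F (q.1.1.val ++ q.2.val ++ q.1.2.val) * x q.2 := by
    rw [Finset.sum_product]
    apply Finset.sum_congr rfl
    intro p _
    rw [Finset.sum_filter]
    apply Finset.sum_congr rfl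
    intro τ _
    by_cases h : content τ = B
    · simp [h]
    · simp [h, hx τ h]
  rw [hL, hR]
  symm
  have hm : ∀ q ∈ pairs B ×ˢ Finset.univ.filter (fun τ : InjWord n => content τ = B),
      q.1 ∈ pairs B ∧ content q.2 = B := by
    intro q hq
    simpa using hq
  refine Finset.sum_bij (fun q hq => (⟨⟨q.1.1.val ++ q.2.val ++ q.1.2.val,
    (pairs_spec (hm q hq).1 (hm q hq).2).1⟩, (pairs_spec (hm q hq).1 (hm q hq).2).2⟩, q.2))
    ?_ ?_ ?_ ?_
  · intro q hq
    exact Finset.mem_filter.2 ⟨Finset.mem_univ _, ⟨_, _, rfl⟩, (hm q hq).2⟩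
  · rintro ⟨⟨⟨l, hl⟩, ⟨r, hr⟩⟩, ⟨t, ht⟩⟩ hq ⟨⟨⟨l', hl'⟩, ⟨r', hr'⟩⟩, ⟨t', ht'⟩⟩ hq' h
    have h1 := congrArg (fun z : FullWord n × InjWord n => z.1.val.val) h
    have h2 := congrArg (fun z : FullWord n × InjWord n => z.2.val) h
    clear h
    simp only at h1 h2
    subst h2
    have n1 := (pairs_spec (hm _ hq).1 (hm _ hq).2).1
    have n2 := (pairs_spec (hm _ hq').1 (hm _ hq').2).1
    have hc := (hm _ hq).2
    simp only at n1 n2 hc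
    cases t with
    | nil =>
      exfalso
      obtain ⟨b, hb⟩ := hB
      rw [← hc, mem_content] at hb
      simp at hb
    | cons a t =>
      have m1 : a ∉ l := by
        intro ha
        simp only [List.append_assoc] at n1
        rw [List.nodup_append'] at n1
        exact n1.2.2 ha (by simp)
      have m2 : a ∉ l' := by
        intro ha
        simp only [List.append_assoc] at n2
        rw [List.nodup_append'] at n2
        exact n2.2.2 ha (by simp)
      have hll : l = l' := by
        have e := congrArg (List.takeWhile (fun c => decide (c ≠ a))) h1
        have gen : ∀ (u v : List (Fin n)), a ∉ u →
            (u ++ a :: v).takeWhile (fun c => decide (c ≠ a)) = u := by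
          intro u v hu
          rw [List.takeWhile_append_of_pos]
          · simp
          · intro c hcu
            simp only [ne_eq, decide_eq_true_eq]
            rintro rfl
            exact hu hcu
        simp only [List.append_assoc, List.cons_append] at e
        rwa [gen _ _ m1, gen _ _ m2] at e
      subst hll
      simp only [List.append_assoc, List.append_cancel_left_eq] at h1
      subst h1
      rfl
  · rintro ⟨⟨⟨s, hs⟩, hsc⟩, τ⟩ hq
    obtain ⟨⟨l, r, e⟩, hc⟩ := (Finset.mem_filter.1 hq).2
    change l ++ τ.val ++ r = s at e
    change content τ = B at hc
    subst e
    have hp : (l ++ r).Nodup ∧ (l ++ r).toFinset = Bᶜ := by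
      have hperm : List.Perm (l ++ τ.val ++ r) (τ.val ++ (l ++ r)) := by
        rw [← List.append_assoc]
        exact List.perm_append_comm.append_right _
      have hs' := (hperm.nodup_iff).1 hs
      rw [List.nodup_append'] at hs'
      refine ⟨hs'.2.1, ?_⟩
      ext a
      have ha : a ∈ l ++ τ.val ++ r := by
        have : a ∈ (l ++ τ.val ++ r).toFinset := by
          change (l ++ τ.val ++ r).toFinset = Finset.univ at hsc
          rw [hsc]; simp
        simpa using this
      rw [hperm.mem_iff, List.mem_append] at ha
      rw [List.mem_toFinset, Finset.mem_compl, ← hc, mem_content]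
      constructor
      · intro h1 h2; exact hs'.2.2 h2 h1
      · intro h1; exact ha.resolve_left h1
    have hp' := hp.1
    rw [List.nodup_append'] at hp'
    refine ⟨((⟨l, hp'.1⟩, ⟨r, hp'.2.1⟩), τ), ?_, rfl⟩
    simp only [Finset.mem_product, pairs, Finset.mem_filter, Finset.mem_univ, true_and]
    exact ⟨hp, hc⟩
  · intro q hq
    rfl

theorem marginal_phi {B : Finset (Fin n)} (hB : B.Nonempty) {x : InjWord n → ℝ}
    (hx : ∀ w, content w ≠ B → x w = 0) (C : Finset (Fin n)) (π : InjWord n) :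
    marginal n C (phi n x) π = ∑ p ∈ pairs B, ∑ τ : InjWord n,
      (if (p.1.val ++ τ.val ++ p.2.val).filter (fun a => a ∈ C) = π.val then 1 else 0) * x τ := by
  rw [← sum_phi hB hx (fun s => if s.filter (fun a => a ∈ C) = π.val then 1 else 0),
    marginal_apply]
  apply Finset.sum_congr rfl
  intro σ _
  simp [restrict, Subtype.ext_iff]

theorem marginal_phi_eq_zero {B C : Finset (Fin n)} {x : InjWord n → ℝ} (hx : x ∈ HSpace n B)
    (h : ¬ B ⊆ C) : marginal n C (phi n x) = 0 := by
  obtain ⟨b, hb, hbC⟩ := Finset.not_subset.1 h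
  funext π
  rw [marginal_phi ⟨b, hb⟩ hx.1]
  apply Finset.sum_eq_zero
  intro p _
  apply sum_H hx hb (fun τ => if (p.1.val ++ τ.val ++ p.2.val).filter (fun a => a ∈ C) = π.val
    then 1 else 0)
  intro τ hτ
  have : (restrict (B.erase b) τ).val.filter (fun a => a ∈ C) =
      τ.val.filter (fun a => a ∈ C) := by
    simp only [restrict, List.filter_filter]
    apply List.filter_congr
    intro a ha
    rw [← mem_content, hτ] at ha
    by_cases hC : a ∈ C
    · have : a ≠ b := fun h' => hbC (h' ▸ hC)
      simp [hC, this, ha]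
    · simp [hC]
  simp only [List.filter_append, this]

theorem marginal_phi_self {B : Finset (Fin n)} (hB : B.Nonempty) {x : InjWord n → ℝ}
    (hx : ∀ w, content w ≠ B → x w = 0) :
    marginal n B (phi n x) = ((pairs B).card : ℝ) • x := by
  funext π
  rw [marginal_phi hB hx, Finset.sum_congr rfl (g := fun _ => x π)]
  · simp
  intro p hp
  simp only [pairs, Finset.mem_filter, Finset.mem_univ, true_and] at hp
  have hout : ∀ a, a ∈ p.1.val ++ p.2.val → a ∉ B := by
    intro a ha
    rwa [← List.mem_toFinset, hp.2, Finset.mem_compl] at ha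
  have e1 : p.1.val.filter (fun a => a ∈ B) = [] := by
    rw [List.filter_eq_nil_iff]
    intro a ha
    simpa using hout a (List.mem_append_left _ ha)
  have e2 : p.2.val.filter (fun a => a ∈ B) = [] := by
    rw [List.filter_eq_nil_iff]
    intro a ha
    simpa using hout a (List.mem_append_right _ ha)
  rw [Finset.sum_eq_single π]
  · by_cases hc : content π = B
    · rw [if_pos, one_mul]
      rw [List.filter_append, List.filter_append, e1, e2, List.nil_append, List.append_nil]
      apply List.filter_eq_self.2
      intro a ha
      rw [← mem_content, hc] at ha
      simpa using ha
    · rw [hx π hc, mul_zero]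
  · intro τ _ hne
    by_cases hc : content τ = B
    · rw [if_neg, zero_mul]
      rw [List.filter_append, List.filter_append, e1, e2, List.nil_append, List.append_nil]
      intro h
      apply hne
      apply Subtype.ext
      rw [← h]
      symm
      apply List.filter_eq_self.2
      intro a ha
      rw [← mem_content, hc] at ha
      simpa using ha
    · rw [hx τ hc, mul_zero]
  · simp

theorem pairs_card_ne (B : Finset (Fin n)) : ((pairs B).card : ℝ) ≠ 0 := by
  have : (⟨[], List.nodup_nil⟩, ⟨Bᶜ.toList, Finset.nodup_toList _⟩) ∈ pairs B := by
    simp [pairs, Finset.nodup_toList]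
  have := Finset.card_pos.2 ⟨_, this⟩
  positivity

theorem marginal_of_subset {A B : Finset (Fin n)} (h : B ⊆ A) {f : FullWord n → ℝ}
    (hf : marginal n A f = 0) : marginal n B f = 0 := by
  funext π
  have : marginal n B f π =
      ∑ τ : InjWord n, if restrict B τ = π then marginal n A f τ else 0 := by
    simp only [marginal_apply, ← Finset.sum_filter (fun τ => restrict B τ = π)]
    rw [Finset.sum_comm]
    apply Finset.sum_congr rfl
    intro σ _
    rw [Finset.sum_ite_eq]
    simp [restrict_restrict B A h]
  rw [this, hf]
  simp

theorem marginal_empty (f : FullWord n → ℝ) :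
    marginal n ∅ f = fun π => if π.val = [] then ∑ σ, f σ else 0 := by
  funext π
  rw [marginal_apply]
  have : ∀ σ : FullWord n, restrict ∅ σ.val = π ↔ π.val = [] := by
    intro σ
    rw [Subtype.ext_iff, restrict]
    simp [eq_comm]
  simp only [this]
  split_ifs <;> simp

theorem marginal_singleton {f : FullWord n → ℝ} (h : ∑ σ, f σ = 0) (b : Fin n) :
    marginal n {b} f = 0 := by
  funext π
  rw [marginal_apply]
  have : ∀ σ : FullWord n, restrict {b} σ.val = π ↔ π.val = [b] := by
    intro σ
    rw [Subtype.ext_iff, restrict]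
    have : σ.val.val.filter (fun a => a ∈ ({b} : Finset (Fin n))) = [b] := by
      have hb : b ∈ σ.val.val := by
        rw [← mem_content, σ.prop]; simp
      apply List.perm_singleton.1
      rw [List.perm_ext_iff_of_nodup (σ.val.prop.filter _) (List.nodup_singleton b)]
      intro a
      simp only [List.mem_filter, Finset.mem_singleton, decide_eq_true_eq, List.mem_singleton]
      exact ⟨fun h => h.2, fun h => ⟨h ▸ hb, h⟩⟩
    simp only [this, eq_comm]
  simp only [this]
  split_ifs <;> simp [h]

theorem card_full_ne : ((Fintype.card (FullWord n) : ℕ) : ℝ) ≠ 0 := by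
  have : Nonempty (FullWord n) := ⟨⟨⟨Finset.univ.toList, Finset.nodup_toList _⟩, by
    simp [content]⟩⟩
  have := Fintype.card_pos (α := FullWord n)
  positivity

theorem marginal_univ {f : FullWord n → ℝ} (h : marginal n Finset.univ f = 0) : f = 0 := by
  funext σ
  have := congrFun h σ.val
  rw [marginal_apply] at this
  have e : ∀ τ : FullWord n, restrict Finset.univ τ.val = σ.val ↔ τ = σ := by
    intro τ
    simp [Subtype.ext_iff, restrict]
  simpa [e] using this

/-- Spanning. -/
theorem span_aux (k : ℕ) (f : FullWord n → ℝ) :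
    ∃ u ∈ V0 n ⊔ (⨆ B ∈ {B : Finset (Fin n) | 2 ≤ B.card}, WSpace n B),
      ∀ C : Finset (Fin n), C.card ≤ k + 1 → marginal n C (f - u) = 0 := by
  induction k with
  | zero =>
    refine ⟨((∑ σ, f σ) / (Fintype.card (FullWord n) : ℝ)) • (fun _ => 1),
      Submodule.mem_sup_left (Submodule.smul_mem _ _ (Submodule.mem_span_singleton_self _)), ?_⟩
    intro C hC
    have hs : ∑ σ, (f - ((∑ σ, f σ) / (Fintype.card (FullWord n) : ℝ)) •
        (fun _ => (1:ℝ) : FullWord n → ℝ) : FullWord n → ℝ) σ = 0 := by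
      simp only [Pi.sub_apply, Pi.smul_apply, smul_eq_mul, mul_one, Finset.sum_sub_distrib,
        Finset.sum_const, Finset.card_univ, nsmul_eq_mul]
      rw [mul_div_cancel₀ _ card_full_ne, sub_self]
    rcases C.eq_empty_or_nonempty with rfl | hne
    · rw [marginal_empty, hs]
      funext π
      simp
    · obtain ⟨b, rfl⟩ := Finset.card_eq_one.1 (le_antisymm hC (Finset.card_pos.2 hne))
      exact marginal_singleton hs b
  | succ k ih =>
    obtain ⟨u, hu, hC⟩ := ih
    set g := f - u with hg
    have hmem : ∀ B : Finset (Fin n), B.card = k + 2 → marginal n B g ∈ HSpace n B := by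
      intro B hB
      apply marginal_mem
      intro b hb
      apply hC
      rw [Finset.card_erase_of_mem hb]; omega
    let w : FullWord n → ℝ := ∑ B ∈ Finset.univ.filter (fun B : Finset (Fin n) => B.card = k + 2),
      phi n (((pairs B).card : ℝ)⁻¹ • marginal n B g)
    refine ⟨u + w, add_mem hu (Submodule.mem_sup_right (sum_mem ?_)), ?_⟩
    · intro B hB
      simp only [Finset.mem_filter, Finset.mem_univ, true_and] at hB
      refine Submodule.mem_iSup_of_mem B (Submodule.mem_iSup_of_mem ?_ ?_)
      · simp [hB]
      · exact Submodule.mem_map_of_mem (Submodule.smul_mem _ _ (hmem B hB))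
    · intro C hCk
      rw [← sub_sub, ← hg, map_sub, map_sum]
      have hz : ∀ B ∈ Finset.univ.filter (fun B : Finset (Fin n) => B.card = k + 2), B ≠ C →
          marginal n C (phi n (((pairs B).card : ℝ)⁻¹ • marginal n B g)) = 0 := by
        intro B hB hne
        simp only [Finset.mem_filter, Finset.mem_univ, true_and] at hB
        apply marginal_phi_eq_zero (Submodule.smul_mem _ _ (hmem B hB))
        intro hs
        exact hne (Finset.eq_of_subset_of_card_le hs (by omega))
      by_cases hc : C.card = k + 2
      · rw [Finset.sum_eq_single C hz (by simp [hc]),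
          marginal_phi_self (Finset.card_pos.1 (by omega))
            (Submodule.smul_mem _ _ (hmem C hc) : _ ∈ HSpace n C).1, smul_smul,
          mul_inv_cancel₀ (pairs_card_ne C), one_smul, sub_self]
      · rw [Finset.sum_eq_zero, hC C (by omega), sub_zero]
        intro B hB
        refine hz B hB ?_
        rintro rfl
        simp at hB
        exact hc hB

theorem span_top : V0 n ⊔ (⨆ B ∈ {B : Finset (Fin n) | 2 ≤ B.card}, WSpace n B) = ⊤ := by
  rw [eq_top_iff]
  intro f _
  obtain ⟨u, hu, h⟩ := span_aux n f
  have := marginal_univ (h Finset.univ (by simp))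
  rw [sub_eq_zero.1 this]
  exact hu

theorem sum_phi_zero {B : Finset (Fin n)} {x : InjWord n → ℝ} (hx : x ∈ HSpace n B)
    (hB : 2 ≤ B.card) : ∑ σ, phi n x σ = 0 := by
  have h := marginal_phi_eq_zero hx (C := ∅) (by
    intro h; rw [Finset.subset_empty.1 h] at hB; simp at hB)
  rw [marginal_empty] at h
  simpa using congrFun h ⟨[], List.nodup_nil⟩

theorem disj (A : Finset (Fin n)) : Disjoint (LinearMap.ker (marginal n A))
      (V0 n ⊔ (⨆ B ∈ {B : Finset (Fin n) | B ⊆ A ∧ 2 ≤ B.card}, WSpace n B)) := by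
  rw [Submodule.disjoint_def]
  intro f hf hU
  rw [LinearMap.mem_ker] at hf
  obtain ⟨v, hv, w, hw, rfl⟩ := Submodule.mem_sup.1 hU
  obtain ⟨c, rfl⟩ := Submodule.mem_span_singleton.1 hv
  have hw' : w ∈ ⨆ B ∈ Finset.univ.filter (fun B : Finset (Fin n) => B ⊆ A ∧ 2 ≤ B.card),
      WSpace n B := by simpa using hw
  obtain ⟨μ, rfl⟩ := (Submodule.mem_iSup_finset_iff_exists_sum _ _).1 hw'
  have hx : ∀ B, ∃ x ∈ HSpace n B, phi n x = μ B := fun B => (μ B).2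
  choose x hxH hxμ using hx
  simp only [← hxμ] at hf ⊢
  have hc : c = 0 := by
    have h0 := marginal_of_subset (Finset.empty_subset A) hf
    rw [marginal_empty] at h0
    have h1 := congrFun h0 ⟨[], List.nodup_nil⟩
    simp only [if_true, Pi.add_apply, Finset.sum_add_distrib, Finset.sum_apply, Pi.zero_apply] at h1
    rw [Finset.sum_comm, Finset.sum_eq_zero (s := Finset.univ.filter _)] at h1
    · simpa [(card_full_ne (n := n))] using h1
    · intro B hB
      simp only [Finset.mem_filter, Finset.mem_univ, true_and] at hB
      exact sum_phi_zero (hxH B) hB.2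
  subst hc
  rw [zero_smul, zero_add] at hf ⊢
  have hz : ∀ B : Finset (Fin n), B ⊆ A → 2 ≤ B.card → x B = 0 := by
    intro B
    induction B using Finset.strongInduction with
    | H B ih =>
      intro hBA hB2
      have h0 := marginal_of_subset hBA hf
      rw [map_sum, Finset.sum_eq_single B] at h0
      · rw [marginal_phi_self (Finset.card_pos.1 (by omega)) (hxH B).1] at h0
        exact (smul_eq_zero.1 h0).resolve_left (pairs_card_ne B)
      · intro B' hB' hne
        simp only [Finset.mem_filter, Finset.mem_univ, true_and] at hB'
        by_cases hs : B' ⊆ B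
        · rw [ih B' (Finset.ssubset_iff_subset_ne.2 ⟨hs, hne⟩) hB'.1 hB'.2]; simp
        · exact marginal_phi_eq_zero (hxH B') hs
      · intro h; exact absurd (by simp [hBA, hB2]) h
  apply Finset.sum_eq_zero
  intro B hB
  simp only [Finset.mem_filter, Finset.mem_univ, true_and] at hB
  rw [hz B hB.1 hB.2, map_zero]

/-- For `A ∈ P([n])`, `ker M_A` and `V⁰ + Σ_{B ∈ P(A)} W_B` are complementary
in `L(S_n)`, and `ker M_A = ⨁_{B ∈ P([n]), B ⊄ A} W_B`. -/
theorem statement10 (n : ℕ) (A : Finset (Fin n)) (hA : 2 ≤ A.card) :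
    IsCompl (LinearMap.ker (marginal n A))
      (V0 n ⊔ (⨆ B ∈ {B : Finset (Fin n) | B ⊆ A ∧ 2 ≤ B.card}, WSpace n B)) ∧
    LinearMap.ker (marginal n A)
      = (⨆ B ∈ {B : Finset (Fin n) | 2 ≤ B.card ∧ ¬ B ⊆ A}, WSpace n B) := by
  have hT : (⨆ B ∈ {B : Finset (Fin n) | 2 ≤ B.card ∧ ¬ B ⊆ A}, WSpace n B) ≤
      LinearMap.ker (marginal n A) := by
    refine iSup₂_le ?_
    rintro B hB _ ⟨x, hx, rfl⟩
    exact LinearMap.mem_ker.2 (marginal_phi_eq_zero hx hB.2)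
  have hsum : (⨆ B ∈ {B : Finset (Fin n) | 2 ≤ B.card ∧ ¬ B ⊆ A}, WSpace n B) ⊔
      (V0 n ⊔ (⨆ B ∈ {B : Finset (Fin n) | B ⊆ A ∧ 2 ≤ B.card}, WSpace n B)) = ⊤ := by
    rw [eq_top_iff, ← span_top]
    refine sup_le (le_sup_of_le_right le_sup_left) (iSup₂_le ?_)
    intro B hB
    by_cases h : B ⊆ A
    · exact le_sup_of_le_right (le_sup_of_le_right (le_iSup₂_of_le B ⟨h, hB⟩ le_rfl))
    · exact le_sup_of_le_left (le_iSup₂_of_le B ⟨hB, h⟩ le_rfl)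
  have hD := disj A
  refine ⟨⟨hD, ?_⟩, ?_⟩
  · rw [codisjoint_iff, eq_top_iff, ← hsum]
    exact sup_le_sup_right hT _
  · refine (eq_of_le_of_inf_le_of_sup_le (z := V0 n ⊔
      (⨆ B ∈ {B : Finset (Fin n) | B ⊆ A ∧ 2 ≤ B.card}, WSpace n B)) hT ?_ ?_).symm
    · rw [hD.eq_bot]; exact bot_le
    · rw [hsum]; exact le_top

end IncompleteRankings
end

section
/- For every k ∈ {2, …, n} and every σ₀ ∈ S_n, the subspaces W^k and V^k of L(S_n) are invariant under the translation T_{σ₀}: T_{σ₀}(W^k) ⊆ W^k and T_{σ₀}(V^k) ⊆ V^k. -/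
open Finset

namespace IncompleteRankings

variable {n : ℕ}

/-- Letterwise image of an injective word under a permutation of `[n]`. -/
def mapW (e : Equiv.Perm (Fin n)) (w : InjWord n) : InjWord n :=
  ⟨w.val.map e, w.prop.map e.injective⟩

noncomputable def mapFull (e : Equiv.Perm (Fin n)) (σ : FullWord n) : FullWord n :=
  ⟨mapW e σ.val, by
    have h := σ.prop
    refine Finset.eq_univ_iff_forall.mpr fun x => ?_
    have hx : e.symm x ∈ σ.val.val := by
      have hmem : e.symm x ∈ content σ.val := by rw [h]; exact Finset.mem_univ _
      simpa [content] using hmem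
    simp only [content, mapW, List.mem_toFinset, List.mem_map]
    exact ⟨e.symm x, hx, e.apply_symm_apply x⟩⟩

/-- The translation operator `T_{σ₀}` restricted to `L(S_n)`, sending the Dirac function of a
permutation `π` (as a full word) to the Dirac function of `σ₀(π)`. -/
noncomputable def transOpS (n : ℕ) (e : Equiv.Perm (Fin n)) :
    (FullWord n → ℝ) →ₗ[ℝ] (FullWord n → ℝ) where
  toFun f := fun σ => f (mapFull e.symm σ)
  map_add' f g := rfl
  map_smul' c f := rfl

/-- The space `W^k = Σ_{|A| = k} W_A`. -/
noncomputable def Wk (n k : ℕ) : Submodule ℝ (FullWord n → ℝ) :=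
  ⨆ A ∈ {A : Finset (Fin n) | A.card = k}, WSpace n A

/-- The space `V^k = V⁰ + Σ_{j=2}^{k} W^j`. -/
noncomputable def Vk (n k : ℕ) : Submodule ℝ (FullWord n → ℝ) :=
  V0 n ⊔ ⨆ j ∈ Finset.Icc 2 k, Wk n j

theorem mapW_symm_mapW (e : Equiv.Perm (Fin n)) (w : InjWord n) :
    mapW e.symm (mapW e w) = w := by
  apply Subtype.ext
  simp [mapW]

theorem mapW_mapW_symm (e : Equiv.Perm (Fin n)) (w : InjWord n) :
    mapW e (mapW e.symm w) = w := by
  apply Subtype.ext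
  simp [mapW]

theorem content_mapW (e : Equiv.Perm (Fin n)) (w : InjWord n) :
    content (mapW e w) = (content w).map e.toEmbedding := by
  ext x
  simp only [content, mapW, List.mem_toFinset, List.mem_map, Finset.mem_map,
    Equiv.coe_toEmbedding]

theorem list_map_insertIdx {α β : Type*} (f : α → β) (a : α) :
    ∀ (l : List α) (i : ℕ), (l.insertIdx i a).map f = (l.map f).insertIdx i (f a)
  | l, 0 => by simp
  | [], (i+1) => by simp
  | (x :: l), (i+1) => by
      simp [List.insertIdx_succ_cons, list_map_insertIdx f a l i]

theorem mapW_insertAt (e : Equiv.Perm (Fin n)) (w : InjWord n) (i : ℕ) (a : Fin n) :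
    mapW e (insertAt w i a) = insertAt (mapW e w) i (e a) := by
  apply Subtype.ext
  by_cases h : a ∈ w.val
  · have h' : e a ∈ (mapW e w).val := List.mem_map_of_mem h
    simp only [insertAt, h, h', dif_pos]
  · have h' : e a ∉ (mapW e w).val := by simpa [mapW] using h
    simp only [insertAt, h, h', dif_neg, not_false_eq_true]
    exact list_map_insertIdx e a w.val i

/-- Translation of the elements of `H_A`. -/
theorem comp_mem_HSpace (e : Equiv.Perm (Fin n)) (A : Finset (Fin n)) (x : InjWord n → ℝ)
    (hx : x ∈ HSpace n A) :
    (fun w => x (mapW e.symm w)) ∈ HSpace n (A.map e.toEmbedding) := by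
  obtain ⟨h1, h2⟩ := hx
  refine ⟨fun w hw => h1 _ fun h => hw ?_, fun a ha ω hω => ?_⟩
  · rw [← h, ← content_mapW, mapW_mapW_symm]
  · have ha' : e.symm a ∈ A := by
      obtain ⟨b, hb, rfl⟩ := Finset.mem_map.mp ha
      simpa using hb
    have hc : content (mapW e.symm ω) = A.erase (e.symm a) := by
      rw [content_mapW, hω]
      ext y
      simp [Equiv.symm_apply_eq, Equiv.eq_symm_apply]
    have := h2 _ ha' _ hc
    simp only [mapW_insertAt]
    simpa [mapW] using this

theorem transOpS_phi (e : Equiv.Perm (Fin n)) (x : InjWord n → ℝ) :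
    transOpS n e (phi n x) = phi n (fun w => x (mapW e.symm w)) := by
  funext σ
  change ∑ π ∈ Finset.univ.filter
      (fun π : InjWord n => π.val <:+: (mapFull e.symm σ).val.val), x π =
    ∑ π ∈ Finset.univ.filter (fun π : InjWord n => π.val <:+: σ.val.val), x (mapW e.symm π)
  refine Finset.sum_bij' (fun π _ => mapW e π) (fun π _ => mapW e.symm π) ?_ ?_ ?_ ?_ ?_
  · intro π hπ
    simp only [Finset.mem_filter, Finset.mem_univ, true_and] at hπ ⊢
    have := hπ.map e
    simpa [mapFull, mapW] using this
  · intro π hπ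
    simp only [Finset.mem_filter, Finset.mem_univ, true_and] at hπ ⊢
    exact hπ.map e.symm
  · intro π _
    exact mapW_symm_mapW e π
  · intro π _
    exact mapW_mapW_symm e π
  · intro π _
    rw [mapW_symm_mapW]

theorem map_Wk_le (k : ℕ) (e : Equiv.Perm (Fin n)) :
    (Wk n k).map (transOpS n e) ≤ Wk n k := by
  rw [Submodule.map_le_iff_le_comap]
  refine iSup₂_le fun A hA => ?_
  rintro _ ⟨x, hx, rfl⟩
  rw [Submodule.mem_comap, transOpS_phi]
  have hA' : A.map e.toEmbedding ∈ {A : Finset (Fin n) | A.card = k} := by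
    simpa using hA
  exact (le_iSup₂_of_le (f := fun (A : Finset (Fin n))
    (_ : A ∈ {A : Finset (Fin n) | A.card = k}) => WSpace n A) _ hA' le_rfl)
    (Submodule.mem_map_of_mem (comp_mem_HSpace e A x hx))

/-- For `2 ≤ k ≤ n` and `σ₀ ∈ S_n`, the spaces `W^k` and `V^k` are invariant
under the translation `T_{σ₀}`. -/
theorem statement14 (n k : ℕ) (hk2 : 2 ≤ k) (hkn : k ≤ n) (σ₀ : Equiv.Perm (Fin n)) :
    (Wk n k).map (transOpS n σ₀) ≤ Wk n k ∧ (Vk n k).map (transOpS n σ₀) ≤ Vk n k := by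
  refine ⟨map_Wk_le k σ₀, ?_⟩
  rw [Vk, Submodule.map_sup]
  refine sup_le_sup ?_ ?_
  · rw [V0, Submodule.map_span, Set.image_singleton]
    exact le_rfl
  · simp only [Submodule.map_iSup]
    exact iSup₂_mono fun j _ => map_Wk_le j σ₀

end IncompleteRankings
end

section
/- Let (P_A)_{A ∈ P([n])} be a family where each P_A is a probability distribution on Γ(A) (i.e., P_A : Γ(A) → ℝ is nonnegative and sums to 1). Then the family satisfies the projectivity condition — for every A ∈ P([n]) with |A| < n, every b ∈ [n] \ A, and every π ∈ Γ(A), P_A(π) = Σ_{i=1}^{|A|+1} P_{A∪{b}}(π◁_i b) — if and only if there exists a probability distribution p on S_n such that P_A = M_A p for every A ∈ P([n]). -/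
open Finset
namespace IncompleteRankings

variable {n : ℕ}

theorem aux_idxOf_insertIdx {α : Type*} [DecidableEq α] (b : α) : ∀ (l : List α) (i : ℕ), b ∉ l →
    i ≤ l.length → (l.insertIdx i b).idxOf b = i
  | l, 0, _, _ => by simp
  | [], (i+1), _, h => by simp at h
  | (x :: l), (i+1), hb, h => by
      simp only [List.mem_cons, not_or] at hb
      rw [List.insertIdx_succ_cons, List.idxOf_cons_ne _ (Ne.symm hb.1),
        aux_idxOf_insertIdx b l i hb.2 (by simpa using h)]

theorem aux_filter_insertIdx {α : Type*} [DecidableEq α] (b : α) : ∀ (l : List α) (i : ℕ), b ∉ l →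
    i ≤ l.length → (l.insertIdx i b).filter (fun a => a ≠ b) = l
  | l, 0, hb, _ => by
      simp only [List.insertIdx_zero]
      rw [List.filter_cons_of_neg (by simp), List.filter_eq_self]
      intro a ha
      simp only [decide_eq_true_eq]
      rintro rfl
      exact hb ha
  | [], (i+1), _, h => by simp at h
  | (x :: l), (i+1), hb, h => by
      simp only [List.mem_cons, not_or] at hb
      rw [List.insertIdx_succ_cons, List.filter_cons_of_pos (by simpa using Ne.symm hb.1),
        aux_filter_insertIdx b l i hb.2 (by simpa using h)]

theorem aux_insertIdx_idxOf {α : Type*} [DecidableEq α] (b : α) : ∀ (v : List α), v.Nodup → b ∈ v →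
    (v.filter (fun a => a ≠ b)).insertIdx (v.idxOf b) b = v ∧
      v.idxOf b ≤ (v.filter (fun a => a ≠ b)).length
  | [], _, h => by simp at h
  | (x :: l), hv, h => by
      rw [List.nodup_cons] at hv
      by_cases hx : x = b
      · subst hx
        have : l.filter (fun a => a ≠ x) = l := by
          rw [List.filter_eq_self]
          intro a ha
          simp only [decide_eq_true_eq]
          rintro rfl
          exact hv.1 ha
        rw [List.filter_cons_of_neg (by simp), this]
        simp
      · have hb : b ∈ l := by
          rcases List.mem_cons.mp h with h | h
          · exact absurd h.symm hx
          · exact h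
        obtain ⟨h1, h2⟩ := aux_insertIdx_idxOf b l hv.2 hb
        rw [List.filter_cons_of_pos (by simpa using hx), List.idxOf_cons_ne _ hx,
          List.insertIdx_succ_cons, h1]
        exact ⟨rfl, by simpa using h2⟩

theorem aux_content_restrict (A : Finset (Fin n)) (σ : FullWord n) :
    content (restrict A σ.val) = A := by
  have h := σ.prop
  ext a
  have : a ∈ content σ.val := by rw [h]; simp
  simp only [content, List.mem_toFinset] at this
  simp [content, restrict, this]

theorem aux_restrict_filter (A : Finset (Fin n)) (b : Fin n) (hb : b ∉ A) (w : InjWord n) :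
    (restrict A w).val = (restrict (insert b A) w).val.filter (fun a => a ≠ b) := by
  simp only [restrict, List.filter_filter]
  apply List.filter_congr
  intro a _
  by_cases h : a = b
  · subst h; simp [hb]
  · simp [h]

theorem aux_pointwise (A : Finset (Fin n)) (b : Fin n) (hb : b ∉ A) (π : InjWord n)
    (hπ : content π = A) (σ : FullWord n) (c : ℝ) :
    (∑ i ∈ Finset.range (π.val.length + 1),
      if restrict (insert b A) σ.val = insertAt π i b then c else 0) =
      if restrict A σ.val = π then c else 0 := by
  have hbπ : b ∉ π.val := by
    intro h
    apply hb
    rw [← hπ]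
    simpa [content] using h
  have hins : ∀ i, (insertAt π i b).val = π.val.insertIdx i b := by
    intro i; simp [insertAt, hbπ]
  have hfil := aux_restrict_filter A b hb σ.val
  have hbv : b ∈ (restrict (insert b A) σ.val).val := by
    have := aux_content_restrict (insert b A) σ
    have h2 : b ∈ content (restrict (insert b A) σ.val) := by rw [this]; simp
    simpa [content] using h2
  obtain ⟨h1, h2⟩ := aux_insertIdx_idxOf b _ (restrict (insert b A) σ.val).prop hbv
  rw [← hfil] at h1 h2
  split_ifs with h
  · rw [h] at h1 h2
    rw [Finset.sum_eq_single ((restrict (insert b A) σ.val).val.idxOf b)]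
    · rw [if_pos]
      apply Subtype.ext
      rw [hins, h1]
    · intro i hi hne
      rw [if_neg]
      intro he
      apply hne
      rw [he, hins, aux_idxOf_insertIdx b _ _ hbπ]
      simpa [Nat.lt_succ_iff] using hi
    · intro hi
      exact absurd (Finset.mem_range.mpr (Nat.lt_succ_of_le h2)) hi
  · apply Finset.sum_eq_zero
    intro i hi
    rw [if_neg]
    intro he
    apply h
    apply Subtype.ext
    rw [hfil, he, hins, aux_filter_insertIdx b _ _ hbπ]
    simpa [Nat.lt_succ_iff] using hi

theorem aux_marginal (A : Finset (Fin n)) (b : Fin n) (hb : b ∉ A) (π : InjWord n)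
    (hπ : content π = A) (p : FullWord n → ℝ) :
    marginal n A p π =
      ∑ i ∈ Finset.range (π.val.length + 1), marginal n (insert b A) p (insertAt π i b) := by
  simp only [marginal, LinearMap.coe_mk, AddHom.coe_mk, Finset.sum_filter]
  rw [Finset.sum_comm]
  exact Finset.sum_congr rfl fun σ _ => (aux_pointwise A b hb π hπ σ (p σ)).symm

theorem aux_marginal_supp (A : Finset (Fin n)) (π : InjWord n)
    (hπ : content π ≠ A) (p : FullWord n → ℝ) : marginal n A p π = 0 := by
  simp only [marginal, LinearMap.coe_mk, AddHom.coe_mk]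
  apply Finset.sum_eq_zero
  intro σ hσ
  rw [Finset.mem_filter] at hσ
  exact absurd (hσ.2 ▸ aux_content_restrict A σ) hπ

theorem aux_restrict_univ (w : InjWord n) : restrict Finset.univ w = w := by
  apply Subtype.ext
  simp [restrict]

theorem aux_marginal_univ (π : FullWord n) (p : FullWord n → ℝ) :
    marginal n Finset.univ p π.val = p π := by
  simp only [marginal, LinearMap.coe_mk, AddHom.coe_mk, aux_restrict_univ, Finset.sum_filter]
  rw [Finset.sum_eq_single π]
  · simp
  · intro σ _ h
    rw [if_neg]
    exact fun h' => h (Subtype.ext h')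
  · simp

/-- A family `(P_A)_{A ∈ P([n])}` of probability distributions on the
`Γ(A)`'s satisfies the projectivity condition iff it is the family of marginals of a
probability distribution `p` on `S_n`. -/
theorem statement19 (n : ℕ) (hn : 2 ≤ n) (P : Finset (Fin n) → (InjWord n → ℝ))
    (hsupp : ∀ A : Finset (Fin n), 2 ≤ A.card → ∀ w : InjWord n, content w ≠ A → P A w = 0)
    (hpos : ∀ A : Finset (Fin n), 2 ≤ A.card → ∀ w : InjWord n, 0 ≤ P A w)
    (hsum : ∀ A : Finset (Fin n), 2 ≤ A.card → ∑ w : InjWord n, P A w = 1) :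
    (∀ A : Finset (Fin n), 2 ≤ A.card → A.card < n → ∀ b : Fin n, b ∉ A →
      ∀ π : InjWord n, content π = A →
        P A π = ∑ i ∈ Finset.range (π.val.length + 1), P (insert b A) (insertAt π i b)) ↔
    (∃ p : FullWord n → ℝ, (∀ σ, 0 ≤ p σ) ∧ (∑ σ : FullWord n, p σ = 1) ∧
      ∀ A : Finset (Fin n), 2 ≤ A.card → P A = marginal n A p) := by
  constructor
  · intro hproj
    have hcu : (Finset.univ : Finset (Fin n)).card = n := by simp
    refine ⟨fun σ => P Finset.univ σ.val, fun σ => hpos _ (by omega) _, ?_, ?_⟩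
    · rw [← hsum Finset.univ (by omega)]
      symm
      rw [← Finset.sum_filter_add_sum_filter_not Finset.univ
        (fun w : InjWord n => content w = Finset.univ)]
      rw [Finset.sum_eq_zero (s := Finset.univ.filter
        (fun w : InjWord n => ¬ content w = Finset.univ)), add_zero]
      · exact Finset.sum_subtype _ (by simp) _
      · intro w hw
        exact hsupp _ (by omega) w (Finset.mem_filter.mp hw).2
    · have key : ∀ k : ℕ, ∀ A : Finset (Fin n), 2 ≤ A.card → A.card + k = n →
          P A = marginal n A (fun σ => P Finset.univ σ.val) := by
        intro k
        induction k with
        | zero =>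
          intro A hA hk
          have : A = Finset.univ := (Finset.card_eq_iff_eq_univ A).mp (by simpa using hk)
          subst this
          funext w
          by_cases hw : content w = Finset.univ
          · exact (aux_marginal_univ ⟨w, hw⟩ (fun σ => P Finset.univ σ.val)).symm
          · rw [hsupp _ hA w hw, aux_marginal_supp _ w hw]
        | succ k ih =>
          intro A hA hk
          funext w
          by_cases hw : content w = A
          · obtain ⟨b, hb⟩ : ∃ b, b ∉ A := by
              by_contra hcon
              push Not at hcon
              have : A = Finset.univ := Finset.eq_univ_iff_forall.mpr hcon
              rw [this] at hk
              omega
            have hc := Finset.card_insert_of_notMem hb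
            rw [hproj A hA (by omega) b hb w hw, aux_marginal A b hb w hw,
              ih (insert b A) (by omega) (by omega)]
          · rw [hsupp _ hA w hw, aux_marginal_supp _ w hw]
      intro A hA
      have : A.card ≤ n := by simpa using Finset.card_le_univ A
      exact key (n - A.card) A hA (by omega)
  · rintro ⟨p, -, -, hp⟩ A hA _ b hb π hπ
    have hc := Finset.card_insert_of_notMem hb
    rw [hp A hA, hp (insert b A) (by omega)]
    exact aux_marginal A b hb π hπ p

end IncompleteRankings
end
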